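/- Let (𝔤, J₁, J₂, J₃) be a hypercomplex real Lie algebra such that J_α𝔤¹ ⊆ 𝔷 for all α = 1,2,3. Then: (i) ∇_X ∇_Y Z = 0 for all X, Y, Z ∈ 𝔤, and the curvature of the Obata connection is R(X,Y)Z = −[[X,Y],Z], i.e. R(X,Y) = −ad_{[X,Y]}; (ii) R ≡ 0 if and only if [𝔤, 𝔤¹] = 0 (𝔤 is at most 2-step nilpotent), so the Obata connection is non-flat if and only if 𝔤 is 3-step nilpotent; (iii) ad_{[X,Y]} ∘ ad_{[Z,W]} = 0 for all X, Y, Z, W ∈ 𝔤, and ∇_U ∘ ad_{[X,Y]} = 0 and ad_{[X,Y]} ∘ ∇_U = 0 for all U, X, Y ∈ 𝔤; in particular the span of {ad_{[X,Y]} : X, Y ∈ 𝔤} contains all curvature endomorphisms and is an abelian Lie subalgebra of End(𝔤). -/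

import Mathlib

noncomputable section

/-- The commutator ideal `𝔤¹ = [𝔤,𝔤]` of a real Lie algebra, as a submodule:
the span of all brackets. -/
def commIdeal (L : Type*) [LieRing L] [LieAlgebra ℝ L] : Submodule ℝ L :=
  Submodule.span ℝ {z : L | ∃ x y : L, ⁅x, y⁆ = z}

/-- The center `𝔷` of a real Lie algebra, as a submodule. -/
def centerSub (L : Type*) [LieRing L] [LieAlgebra ℝ L] : Submodule ℝ L where
  carrier := {z : L | ∀ x : L, ⁅z, x⁆ = 0}
  add_mem' := by
    intro a b ha hb x
    rw [add_lie, ha x, hb x, add_zero]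
  zero_mem' := fun x => zero_lie x
  smul_mem' := by
    intro c a ha x
    rw [smul_lie, ha x, smul_zero]

/-- The Nijenhuis tensor of an endomorphism `J` of a Lie algebra. -/
def nijenhuis {L : Type*} [LieRing L] [LieAlgebra ℝ L] (J : Module.End ℝ L) (X Y : L) : L :=
  ⁅X, Y⁆ + J (⁅J X, Y⁆ + ⁅X, J Y⁆) - ⁅J X, J Y⁆

/-- A complex structure on a real Lie algebra: `J² = -id` and `N_J ≡ 0`. -/
structure IsComplexStructure {L : Type*} [LieRing L] [LieAlgebra ℝ L]
    (J : Module.End ℝ L) : Prop where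
  sq : ∀ X : L, J (J X) = -X
  integrable : ∀ X Y : L, nijenhuis J X Y = 0

/-- A hypercomplex structure `(J₁,J₂,J₃)` on a real Lie algebra. -/
structure IsHypercomplex {L : Type*} [LieRing L] [LieAlgebra ℝ L]
    (J1 J2 J3 : Module.End ℝ L) : Prop where
  c1 : IsComplexStructure J1
  c2 : IsComplexStructure J2
  c3 : IsComplexStructure J3
  q12 : ∀ X : L, J1 (J2 X) = J3 X
  q21 : ∀ X : L, J2 (J1 X) = -J3 X

/-- The Obata connection `∇_X Y` of a hypercomplex Lie algebra. -/
def obata {L : Type*} [LieRing L] [LieAlgebra ℝ L] (J1 J2 J3 : Module.End ℝ L)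
    (X Y : L) : L :=
  (1/2 : ℝ) • (⁅X, Y⁆ + J1 ⁅J1 X, Y⁆ - J2 ⁅X, J2 Y⁆ + J3 ⁅J1 X, J2 Y⁆)

/-- The curvature tensor `R(X,Y)Z` of the Obata connection. -/
def obataCurv {L : Type*} [LieRing L] [LieAlgebra ℝ L] (J1 J2 J3 : Module.End ℝ L)
    (X Y Z : L) : L :=
  obata J1 J2 J3 X (obata J1 J2 J3 Y Z) - obata J1 J2 J3 Y (obata J1 J2 J3 X Z)
    - obata J1 J2 J3 ⁅X, Y⁆ Z

/-- The Obata connection `∇_X` as an endomorphism of `𝔤`. -/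
def obataEnd {L : Type*} [LieRing L] [LieAlgebra ℝ L] (J1 J2 J3 : Module.End ℝ L)
    (X : L) : Module.End ℝ L :=
  (1/2 : ℝ) • (LieAlgebra.ad ℝ L X + J1 * LieAlgebra.ad ℝ L (J1 X)
    - J2 * LieAlgebra.ad ℝ L X * J2 + J3 * LieAlgebra.ad ℝ L (J1 X) * J2)

/-- The curvature endomorphism `R(X,Y)` of the Obata connection. -/
def obataCurvEnd {L : Type*} [LieRing L] [LieAlgebra ℝ L] (J1 J2 J3 : Module.End ℝ L)
    (X Y : L) : Module.End ℝ L :=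
  obataEnd J1 J2 J3 X * obataEnd J1 J2 J3 Y - obataEnd J1 J2 J3 Y * obataEnd J1 J2 J3 X
    - obataEnd J1 J2 J3 ⁅X, Y⁆

section Obata

variable {L : Type*} [LieRing L] [LieAlgebra ℝ L] {J J1 J2 J3 : Module.End ℝ L}

theorem lie_mem_commIdeal (X Y : L) : ⁅X, Y⁆ ∈ commIdeal L :=
  Submodule.subset_span ⟨X, Y, rfl⟩

theorem lie_apply_eq_zero (hc : (commIdeal L).map J ≤ centerSub L) (X : L) {U : L}
    (hU : U ∈ commIdeal L) : ⁅X, J U⁆ = 0 := by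
  rw [← lie_skew, hc (Submodule.mem_map_of_mem hU) X, neg_zero]

theorem apply_lie_eq_zero (hc : (commIdeal L).map J ≤ centerSub L) {U : L}
    (hU : U ∈ commIdeal L) (X : L) : ⁅J U, X⁆ = 0 :=
  hc (Submodule.mem_map_of_mem hU) X

/-- A complex structure mapping `𝔤¹` into the center is linear with respect to the bracket
with elements of `𝔤¹`. -/
theorem IsComplexStructure.apply_lie (hJ : IsComplexStructure J)
    (hc : (commIdeal L).map J ≤ centerSub L) (X : L) {U : L} (hU : U ∈ commIdeal L) :
    ⁅J X, U⁆ = J ⁅X, U⁆ := by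
  have h := hJ.integrable (J X) U
  simp only [nijenhuis, lie_apply_eq_zero hc _ hU, hJ.sq, neg_lie, add_zero, sub_zero,
    map_neg] at h
  exact eq_of_sub_eq_zero (by rw [sub_eq_add_neg, h])

theorem IsComplexStructure.lie_apply (hJ : IsComplexStructure J)
    (hc : (commIdeal L).map J ≤ centerSub L) {U : L} (hU : U ∈ commIdeal L) (X : L) :
    ⁅U, J X⁆ = J ⁅U, X⁆ := by
  rw [← lie_skew, hJ.apply_lie hc X hU, ← lie_skew U X, map_neg]

theorem IsComplexStructure.lie_lie_eq_zero (hJ : IsComplexStructure J)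
    (hc : (commIdeal L).map J ≤ centerSub L) {U V : L} (hU : U ∈ commIdeal L)
    (hV : V ∈ commIdeal L) : ⁅U, V⁆ = 0 := by
  have h := hJ.apply_lie hc U hV
  rw [apply_lie_eq_zero hc hU] at h
  rw [← neg_eq_zero, ← hJ.sq, ← h, map_zero]

theorem obataEnd_apply (X Y : L) : obataEnd J1 J2 J3 X Y = obata J1 J2 J3 X Y := by
  simp [obataEnd, obata]

theorem obataCurvEnd_apply (X Y Z : L) :
    obataCurvEnd J1 J2 J3 X Y Z = obataCurv J1 J2 J3 X Y Z := by
  simp [obataCurvEnd, obataCurv, obataEnd_apply]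

namespace IsHypercomplex

theorem apply_three_one (hH : IsHypercomplex J1 J2 J3) (X : L) : J3 (J1 X) = J2 X := by
  rw [← hH.q12, hH.q21 X, map_neg, ← hH.q12, hH.c1.sq, neg_neg]

theorem apply_two_three (hH : IsHypercomplex J1 J2 J3) (X : L) : J2 (J3 X) = J1 X := by
  rw [← neg_neg (J3 X), ← hH.q21, map_neg, hH.c2.sq, neg_neg]

variable (hH : IsHypercomplex J1 J2 J3) (hc1 : (commIdeal L).map J1 ≤ centerSub L)
  (hc2 : (commIdeal L).map J2 ≤ centerSub L) (hc3 : (commIdeal L).map J3 ≤ centerSub L)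

include hH hc1

section

include hc3

theorem obata_apply_one (X : L) {U : L} (hU : U ∈ commIdeal L) :
    obata J1 J2 J3 X (J1 U) = 0 := by
  simp [obata, lie_apply_eq_zero hc1 _ hU, hH.q21, lie_apply_eq_zero hc3 _ hU]

theorem obata_apply_three (X : L) {U : L} (hU : U ∈ commIdeal L) :
    obata J1 J2 J3 X (J3 U) = 0 := by
  simp [obata, lie_apply_eq_zero hc1 _ hU, hH.apply_two_three, lie_apply_eq_zero hc3 _ hU]

end

include hc2

theorem obata_of_mem_right (X : L) {U : L} (hU : U ∈ commIdeal L) :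
    obata J1 J2 J3 X U = 0 := by
  simp only [obata, lie_apply_eq_zero hc2 _ hU, hH.c1.apply_lie hc1 X hU, hH.c1.sq, map_zero]
  module

theorem obata_of_mem_left {U : L} (hU : U ∈ commIdeal L) (Z : L) :
    obata J1 J2 J3 U Z = ⁅U, Z⁆ := by
  simp only [obata, apply_lie_eq_zero hc1 hU, hH.c2.lie_apply hc2 hU, hH.c2.sq, map_zero]
  module

theorem obata_apply_two (X : L) {U : L} (hU : U ∈ commIdeal L) :
    obata J1 J2 J3 X (J2 U) = 0 := by
  simp only [obata, lie_apply_eq_zero hc2 _ hU, hH.c2.sq, hH.c1.apply_lie hc1 X hU, lie_neg,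
    map_neg, map_zero, hH.apply_three_one]
  module

include hc3

theorem lie_obata_of_mem_left {U : L} (hU : U ∈ commIdeal L) (X Y : L) :
    ⁅U, obata J1 J2 J3 X Y⁆ = 0 := by
  simp [obata, lie_apply_eq_zero hc1, lie_apply_eq_zero hc2, lie_apply_eq_zero hc3,
    lie_mem_commIdeal, hH.c1.lie_lie_eq_zero hc1 hU]

theorem obata_obata (X Y Z : L) : obata J1 J2 J3 X (obata J1 J2 J3 Y Z) = 0 := by
  rw [← obataEnd_apply X, obata.eq_def J1 J2 J3 Y Z]
  simp only [map_smul, map_add, map_sub, obataEnd_apply]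
  rw [hH.obata_of_mem_right hc1 hc2 X (lie_mem_commIdeal _ _),
    hH.obata_apply_one hc1 hc3 X (lie_mem_commIdeal _ _),
    hH.obata_apply_two hc1 hc2 X (lie_mem_commIdeal _ _),
    hH.obata_apply_three hc1 hc3 X (lie_mem_commIdeal _ _)]
  simp

theorem obataCurv_eq (X Y Z : L) : obataCurv J1 J2 J3 X Y Z = -⁅⁅X, Y⁆, Z⁆ := by
  simp [obataCurv, hH.obata_obata hc1 hc2 hc3,
    hH.obata_of_mem_left hc1 hc2 (lie_mem_commIdeal X Y)]

end IsHypercomplex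

end Obata

/-- Let `(𝔤,J₁,J₂,J₃)` be hypercomplex with `J_α𝔤¹ ⊆ 𝔷` for all `α`. Then:
(i) `∇_X∇_Y Z = 0` and `R(X,Y)Z = −[[X,Y],Z]`, i.e. `R(X,Y) = −ad_{[X,Y]}`;
(ii) `R ≡ 0` iff `[𝔤,𝔤¹] = 0`;
(iii) `ad_{[X,Y]} ∘ ad_{[Z,W]} = 0`, `∇_U ∘ ad_{[X,Y]} = 0` and `ad_{[X,Y]} ∘ ∇_U = 0`;
in particular the span of the `ad_{[X,Y]}` contains all curvature endomorphisms and is an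
abelian Lie subalgebra of `End(𝔤)`. -/
theorem stmt_19 {L : Type*} [LieRing L] [LieAlgebra ℝ L] [FiniteDimensional ℝ L]
    (J1 J2 J3 : Module.End ℝ L) (hH : IsHypercomplex J1 J2 J3)
    (hc1 : (commIdeal L).map J1 ≤ centerSub L)
    (hc2 : (commIdeal L).map J2 ≤ centerSub L)
    (hc3 : (commIdeal L).map J3 ≤ centerSub L) :
    (∀ X Y Z : L, obata J1 J2 J3 X (obata J1 J2 J3 Y Z) = 0) ∧
    (∀ X Y Z : L, obataCurv J1 J2 J3 X Y Z = -⁅⁅X, Y⁆, Z⁆) ∧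
    ((∀ X Y Z : L, obataCurv J1 J2 J3 X Y Z = 0) ↔
      (∀ X : L, ∀ Y ∈ commIdeal L, ⁅X, Y⁆ = 0)) ∧
    (∀ X Y Z W : L,
      LieAlgebra.ad ℝ L ⁅X, Y⁆ * LieAlgebra.ad ℝ L ⁅Z, W⁆ = 0) ∧
    (∀ U X Y : L,
      obataEnd J1 J2 J3 U * LieAlgebra.ad ℝ L ⁅X, Y⁆ = 0 ∧
      LieAlgebra.ad ℝ L ⁅X, Y⁆ * obataEnd J1 J2 J3 U = 0) ∧
    (∀ X Y : L, obataCurvEnd J1 J2 J3 X Y ∈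
      Submodule.span ℝ {A : Module.End ℝ L | ∃ Z W : L, LieAlgebra.ad ℝ L ⁅Z, W⁆ = A}) ∧
    (∀ a ∈ Submodule.span ℝ {A : Module.End ℝ L | ∃ Z W : L, LieAlgebra.ad ℝ L ⁅Z, W⁆ = A},
     ∀ b ∈ Submodule.span ℝ {A : Module.End ℝ L | ∃ Z W : L, LieAlgebra.ad ℝ L ⁅Z, W⁆ = A},
      ⁅a, b⁆ = 0) := by
  have hR := hH.obataCurv_eq hc1 hc2 hc3
  have hAA (X Y Z W : L) : LieAlgebra.ad ℝ L ⁅X, Y⁆ * LieAlgebra.ad ℝ L ⁅Z, W⁆ = 0 :=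
    LinearMap.ext fun V => hH.c1.lie_lie_eq_zero hc1 (lie_mem_commIdeal X Y)
      (lie_mem_commIdeal ⁅Z, W⁆ V)
  have hS : ∀ a ∈ Submodule.span ℝ {A | ∃ Z W : L, LieAlgebra.ad ℝ L ⁅Z, W⁆ = A},
      ∀ b ∈ Submodule.span ℝ {A | ∃ Z W : L, LieAlgebra.ad ℝ L ⁅Z, W⁆ = A}, a * b = 0 := by
    intro a ha b hb
    induction ha, hb using Submodule.span_induction₂ with
    | mem_mem a b ha hb =>
      obtain ⟨X, Y, rfl⟩ := ha
      obtain ⟨Z, W, rfl⟩ := hb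
      exact hAA X Y Z W
    | zero_left b _ => exact zero_mul b
    | zero_right a _ => exact mul_zero a
    | add_left a b c _ _ _ h₁ h₂ => rw [add_mul, h₁, h₂, add_zero]
    | add_right a b c _ _ _ h₁ h₂ => rw [mul_add, h₁, h₂, add_zero]
    | smul_left r a b _ _ h => rw [smul_mul_assoc, h, smul_zero]
    | smul_right r a b _ _ h => rw [mul_smul_comm, h, smul_zero]
  refine ⟨hH.obata_obata hc1 hc2 hc3, hR, ⟨fun h X Y hY => ?_, fun h X Y Z => ?_⟩, hAA,
    fun U X Y => ⟨LinearMap.ext fun V => ?_, LinearMap.ext fun V => ?_⟩, fun X Y => ?_,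
    fun a ha b hb => ?_⟩
  · induction hY using Submodule.span_induction with
    | mem Y hY =>
      obtain ⟨x, y, rfl⟩ := hY
      rw [← lie_skew, ← hR, h]
    | zero => exact lie_zero X
    | add Y Z _ _ hY hZ => rw [lie_add, hY, hZ, add_zero]
    | smul c Y _ hY => rw [lie_smul, hY, smul_zero]
  · rw [hR, lie_skew, h Z _ (lie_mem_commIdeal X Y)]
  · simpa [obataEnd_apply] using
      hH.obata_of_mem_right hc1 hc2 U (lie_mem_commIdeal ⁅X, Y⁆ V)
  · rw [Module.End.mul_apply, obataEnd_apply, LieAlgebra.ad_apply, LinearMap.zero_apply]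
    exact hH.lie_obata_of_mem_left hc1 hc2 hc3 (lie_mem_commIdeal X Y) U V
  · have h : obataCurvEnd J1 J2 J3 X Y = -LieAlgebra.ad ℝ L ⁅X, Y⁆ :=
      LinearMap.ext fun Z => (obataCurvEnd_apply X Y Z).trans (hR X Y Z)
    rw [h]
    exact neg_mem (Submodule.subset_span ⟨X, Y, rfl⟩)
  · rw [Ring.lie_def, hS a ha b hb, hS b hb a ha, sub_zero]
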